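/- Let H be a real Hilbert space, n, l ≥ 1, and for j = 1,…,l let C_j : H → H be monotone and L_j-Lipschitz continuous with L_j > 0. Let P, Q ∈ ℝ^{n×l} and R ∈ ℝ^{l×n} be matrices, and define C : H^l → H^l componentwise by C(u)_j = C_j(u_j). Let x, x̄ ∈ H^n satisfy (Pᵀ⊗Id)x̄ = (R⊗Id)x̄. Then: −⟨x − x̄, ((P−Q)⊗Id)C((R⊗Id)x) + (Q⊗Id)C((Pᵀ⊗Id)x) − ((P−Q)⊗Id)C((R⊗Id)x̄) − (Q⊗Id)C((Pᵀ⊗Id)x̄)⟩ ≤ (1/2) ∑_{j=1}^l L_j ‖(((Pᵀ − Qᵀ)⊗Id)(x − x̄))_j‖² + (1/2) ∑_{j=1}^l L_j ‖(((Pᵀ − R)⊗Id)(x − x̄))_j‖². -/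

import Mathlib

open RealInnerProductSpace Finset

/-- For a monotone `K`-Lipschitz operator `T`, replacing `T t` by `T s` along the direction
`t - w - v` costs at most the two quadratic terms on the right. -/
lemma neg_inner_reflected_le {H : Type*} [NormedAddCommGroup H] [InnerProductSpace ℝ H]
    {T : H → H} {K : ℝ} (hK : 0 ≤ K)
    (hmono : ∀ u w : H, 0 ≤ ⟪T u - T w, u - w⟫)
    (hlip : ∀ u w : H, ‖T u - T w‖ ≤ K * ‖u - w‖) (s t w v : H) :
    -(⟪t - w - v, T s - T w⟫ + ⟪v, T t - T w⟫)
      ≤ 1 / 2 * (K * ‖t - w - v‖ ^ 2) + 1 / 2 * (K * ‖t - s‖ ^ 2) := by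
  have hsplit : ⟪t - w - v, T s - T w⟫ + ⟪v, T t - T w⟫
      = ⟪T t - T w, t - w⟫ - ⟪t - w - v, T t - T s⟫ := by
    rw [real_inner_comm (t - w) (T t - T w)]
    simp only [inner_sub_left, inner_sub_right]
    ring
  have hcs : ⟪t - w - v, T t - T s⟫ ≤ ‖t - w - v‖ * (K * ‖t - s‖) :=
    (real_inner_le_norm _ _).trans (mul_le_mul_of_nonneg_left (hlip t s) (norm_nonneg _))
  have hyoung := mul_nonneg hK (sq_nonneg (‖t - w - v‖ - ‖t - s‖))
  have hm := hmono t w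
  rw [hsplit]
  linarith

/-- The lifted operator `M ⊗ Id` has adjoint `Mᵀ ⊗ Id`. -/
lemma sum_inner_sum_smul {H ι κ : Type*} [NormedAddCommGroup H] [InnerProductSpace ℝ H]
    [Fintype ι] [Fintype κ] (M : ι → κ → ℝ) (d : ι → H) (c : κ → H) :
    ∑ i, ⟪d i, ∑ j, M i j • c j⟫ = ∑ j, ⟪∑ i, M i j • d i, c j⟫ := by
  simp only [inner_sum, sum_inner, real_inner_smul_left, real_inner_smul_right]
  exact sum_comm

/-- The reflected-term estimate (inequality (104)) in the proof of Lemma 4.2: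
for monotone L_j-Lipschitz operators C_j, matrices P, Q ∈ ℝ^{n×l}, R ∈ ℝ^{l×n},
and points x, x' ∈ H^n with (Pᵀ⊗Id)x' = (R⊗Id)x',
`-⟨x - x', ((P-Q)⊗Id)C((R⊗Id)x) + (Q⊗Id)C((Pᵀ⊗Id)x)
          - ((P-Q)⊗Id)C((R⊗Id)x') - (Q⊗Id)C((Pᵀ⊗Id)x')⟩
  ≤ (1/2) ∑_j L_j ‖(((Pᵀ-Qᵀ)⊗Id)(x-x'))_j‖² + (1/2) ∑_j L_j ‖(((Pᵀ-R)⊗Id)(x-x'))_j‖²`. -/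
theorem reflected_term_estimate
    {H : Type*} [NormedAddCommGroup H] [InnerProductSpace ℝ H] [CompleteSpace H]
    (n l : ℕ) (hn : 1 ≤ n) (hl : 1 ≤ l)
    (C : Fin l → H → H) (L : Fin l → ℝ) (hLpos : ∀ j, 0 < L j)
    (hmono : ∀ j, ∀ u w : H, ⟪C j u - C j w, u - w⟫ ≥ 0)
    (hlip : ∀ j, ∀ u w : H, ‖C j u - C j w‖ ≤ L j * ‖u - w‖)
    (P Q : Matrix (Fin n) (Fin l) ℝ) (R : Matrix (Fin l) (Fin n) ℝ)
    (x x' : Fin n → H)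
    (hfix : ∀ j : Fin l, ∑ i, P i j • x' i = ∑ i, R j i • x' i) :
    -(∑ i, ⟪x i - x' i,
        ((∑ j, (P i j - Q i j) • C j (∑ h, R j h • x h)) +
         (∑ j, Q i j • C j (∑ h, P h j • x h))) -
        ((∑ j, (P i j - Q i j) • C j (∑ h, R j h • x' h)) +
         (∑ j, Q i j • C j (∑ h, P h j • x' h)))⟫)
      ≤ (1 / 2) * ∑ j, L j * ‖∑ i, (P i j - Q i j) • (x i - x' i)‖ ^ 2
        + (1 / 2) * ∑ j, L j * ‖∑ i, (P i j - R j i) • (x i - x' i)‖ ^ 2 := by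
  have hadj : ∑ i, ⟪x i - x' i,
        ((∑ j, (P i j - Q i j) • C j (∑ h, R j h • x h)) +
         (∑ j, Q i j • C j (∑ h, P h j • x h))) -
        ((∑ j, (P i j - Q i j) • C j (∑ h, R j h • x' h)) +
         (∑ j, Q i j • C j (∑ h, P h j • x' h)))⟫
      = ∑ j, (⟪∑ i, (P i j - Q i j) • (x i - x' i),
            C j (∑ h, R j h • x h) - C j (∑ h, R j h • x' h)⟫
          + ⟪∑ i, Q i j • (x i - x' i),
            C j (∑ h, P h j • x h) - C j (∑ h, P h j • x' h)⟫) := by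
    rw [sum_add_distrib, ← sum_inner_sum_smul (fun i j => P i j - Q i j) (fun i => x i - x' i),
      ← sum_inner_sum_smul Q (fun i => x i - x' i), ← sum_add_distrib]
    refine sum_congr rfl fun i _ => ?_
    simp only [← inner_add_right, smul_sub, sum_sub_distrib]
    congr 1
    abel
  rw [hadj, mul_sum, mul_sum, ← sum_neg_distrib, ← sum_add_distrib]
  refine sum_le_sum fun j _ => ?_
  have hPQ : ∑ i, (P i j - Q i j) • (x i - x' i)
      = ∑ i, P i j • x i - ∑ i, P i j • x' i - ∑ i, Q i j • (x i - x' i) := by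
    simp only [sub_smul, smul_sub, sum_sub_distrib]
    abel
  have hPR : ∑ i, (P i j - R j i) • (x i - x' i)
      = ∑ i, P i j • x i - ∑ i, R j i • x i := by
    simp only [sub_smul, smul_sub, sum_sub_distrib, hfix j]
    abel
  rw [hPQ, hPR, ← hfix j]
  exact neg_inner_reflected_le (hLpos j).le (hmono j) (hlip j) _ _ _ _
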